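/- arXiv:math/0506451 — 5 statements merged into one kernel-verified Lean document; each statement's English description precedes it below -/
import Mathlib

section
/- A topological groupoid is étale (d is a local homeomorphism) if and only if the image u(G₀) is an open subset of G₁ and the pointwise product U·V of any two open subsets U, V ⊆ G₁ is open in G₁. -/
/-- A topological groupoid with unit space `G₀` and arrow space `G₁`. -/
structure TopGroupoid (G₀ G₁ : Type*) [TopologicalSpace G₀] [TopologicalSpace G₁] where
  /-- domain map -/
  d : G₁ → G₀
  /-- range map -/
  r : G₁ → G₀
  /-- unit map -/
  u : G₀ → G₁
  /-- inverse map -/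
  i : G₁ → G₁
  /-- multiplication, defined on the subspace of composable pairs -/
  m : {p : G₁ × G₁ // r p.1 = d p.2} → G₁
  continuous_d : Continuous d
  continuous_r : Continuous r
  continuous_u : Continuous u
  continuous_i : Continuous i
  continuous_m : Continuous m
  d_u : ∀ a, d (u a) = a
  r_u : ∀ a, r (u a) = a
  d_m : ∀ p, d (m p) = d p.1.1
  r_m : ∀ p, r (m p) = r p.1.2
  d_i : ∀ x, d (i x) = r x
  r_i : ∀ x, r (i x) = d x
  i_i : ∀ x, i (i x) = x
  mul_unit_left : ∀ x, m ⟨(u (d x), x), r_u (d x)⟩ = x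
  mul_unit_right : ∀ x, m ⟨(x, u (r x)), (d_u (r x)).symm⟩ = x
  mul_inv_left : ∀ x, m ⟨(i x, x), r_i x⟩ = u (r x)
  mul_inv_right : ∀ x, m ⟨(x, i x), (d_i x).symm⟩ = u (d x)
  mul_assoc : ∀ (x y z : G₁) (hxy : r x = d y) (hyz : r y = d z),
    m ⟨(m ⟨(x, y), hxy⟩, z), (r_m ⟨(x, y), hxy⟩).trans hyz⟩ =
    m ⟨(x, m ⟨(y, z), hyz⟩), hxy.trans (d_m ⟨(y, z), hyz⟩).symm⟩

variable {G₀ G₁ : Type*} [TopologicalSpace G₀] [TopologicalSpace G₁]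

/-- Pointwise product of two subsets of the arrow space. -/
def TopGroupoid.setMul (𝒢 : TopGroupoid G₀ G₁) (U V : Set G₁) : Set G₁ :=
  {z | ∃ p : {p : G₁ × G₁ // 𝒢.r p.1 = 𝒢.d p.2}, p.1.1 ∈ U ∧ p.1.2 ∈ V ∧ z = 𝒢.m p}

namespace TopGroupoid

open Set Topology

theorem m_congr (𝒢 : TopGroupoid G₀ G₁) {x y x' y' : G₁} (h : 𝒢.r x = 𝒢.d y)
    (hx : x = x') (hy : y = y') :
    𝒢.m ⟨(x, y), h⟩ = 𝒢.m ⟨(x', y'), hx ▸ hy ▸ h⟩ := by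
  subst hx hy
  rfl

/-- Left division `x⁻¹ y` of two arrows with the same domain. -/
def leftDiv (𝒢 : TopGroupoid G₀ G₁) (p : {p : G₁ × G₁ // 𝒢.d p.1 = 𝒢.d p.2}) : G₁ :=
  𝒢.m ⟨(𝒢.i p.1.1, p.1.2), (𝒢.r_i p.1.1).trans p.2⟩

theorem continuous_leftDiv (𝒢 : TopGroupoid G₀ G₁) : Continuous 𝒢.leftDiv :=
  𝒢.continuous_m.comp <| Continuous.subtype_mk
    ((𝒢.continuous_i.comp continuous_subtype_val.fst).prodMk continuous_subtype_val.snd) _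

theorem d_leftDiv (𝒢 : TopGroupoid G₀ G₁) {x y : G₁} (h : 𝒢.d x = 𝒢.d y) :
    𝒢.d (𝒢.leftDiv ⟨(x, y), h⟩) = 𝒢.r x :=
  (𝒢.d_m _).trans (𝒢.d_i x)

theorem mul_leftDiv (𝒢 : TopGroupoid G₀ G₁) {x y : G₁} (h : 𝒢.d x = 𝒢.d y) :
    𝒢.m ⟨(x, 𝒢.leftDiv ⟨(x, y), h⟩), (𝒢.d_leftDiv h).symm⟩ = y := by
  have key := 𝒢.mul_assoc x (𝒢.i x) y (𝒢.d_i x).symm ((𝒢.r_i x).trans h)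
  refine key.symm.trans ?_
  rw [𝒢.m_congr _ ((𝒢.mul_inv_right x).trans (congrArg 𝒢.u h)) rfl]
  exact 𝒢.mul_unit_left y

theorem leftDiv_mul (𝒢 : TopGroupoid G₀ G₁) {x y : G₁} (h : 𝒢.r x = 𝒢.d y) :
    𝒢.leftDiv ⟨(x, 𝒢.m ⟨(x, y), h⟩), (𝒢.d_m ⟨(x, y), h⟩).symm⟩ = y := by
  have key := 𝒢.mul_assoc (𝒢.i x) x y (𝒢.r_i x) h
  refine key.symm.trans ?_
  rw [𝒢.m_congr _ ((𝒢.mul_inv_left x).trans (congrArg 𝒢.u h)) rfl]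
  exact 𝒢.mul_unit_left y

theorem leftDiv_self (𝒢 : TopGroupoid G₀ G₁) (x : G₁) :
    𝒢.leftDiv ⟨(x, x), rfl⟩ = 𝒢.u (𝒢.r x) :=
  𝒢.mul_inv_left x

theorem eq_of_leftDiv_mem_range_u (𝒢 : TopGroupoid G₀ G₁) {x y : G₁} (h : 𝒢.d x = 𝒢.d y)
    (hu : 𝒢.leftDiv ⟨(x, y), h⟩ ∈ range 𝒢.u) : x = y := by
  obtain ⟨a, ha⟩ := hu
  have har : a = 𝒢.r x := by rw [← 𝒢.d_leftDiv h, ← ha, 𝒢.d_u]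
  subst har
  rw [← 𝒢.mul_leftDiv h, 𝒢.m_congr _ rfl ha.symm]
  exact (𝒢.mul_unit_right x).symm

theorem exists_open_leftDiv_mem (𝒢 : TopGroupoid G₀ G₁) {W : Set G₁} (hW : IsOpen W)
    {x y : G₁} (h : 𝒢.d x = 𝒢.d y) (hxy : 𝒢.leftDiv ⟨(x, y), h⟩ ∈ W) :
    ∃ A B : Set G₁, IsOpen A ∧ IsOpen B ∧ x ∈ A ∧ y ∈ B ∧
      ∀ x' ∈ A, ∀ y' ∈ B, ∀ h' : 𝒢.d x' = 𝒢.d y', 𝒢.leftDiv ⟨(x', y'), h'⟩ ∈ W := by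
  obtain ⟨O, hO, hOW⟩ := isOpen_induced_iff.1 (hW.preimage 𝒢.continuous_leftDiv)
  have mem_iff {x' y' : G₁} (h' : 𝒢.d x' = 𝒢.d y') :
      (x', y') ∈ O ↔ 𝒢.leftDiv ⟨(x', y'), h'⟩ ∈ W :=
    Set.ext_iff.1 hOW ⟨(x', y'), h'⟩
  obtain ⟨A, B, hA, hB, hxA, hyB, hAB⟩ := isOpen_prod_iff.1 hO x y ((mem_iff h).2 hxy)
  exact ⟨A, B, hA, hB, hxA, hyB, fun x' hx' y' hy' h' => (mem_iff h').1 (hAB ⟨hx', hy'⟩)⟩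

theorem mem_setMul_iff (𝒢 : TopGroupoid G₀ G₁) {U V : Set G₁} {z : G₁} :
    z ∈ 𝒢.setMul U V ↔ ∃ x ∈ U, ∃ h : 𝒢.d x = 𝒢.d z, 𝒢.leftDiv ⟨(x, z), h⟩ ∈ V := by
  constructor
  · rintro ⟨⟨⟨x, y⟩, h⟩, hx, hy, rfl⟩
    exact ⟨x, hx, (𝒢.d_m ⟨(x, y), h⟩).symm, (𝒢.leftDiv_mul h).symm ▸ hy⟩
  · rintro ⟨x, hx, h, hV⟩
    exact ⟨⟨(x, _), (𝒢.d_leftDiv h).symm⟩, hx, hV, (𝒢.mul_leftDiv h).symm⟩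

theorem isOpen_setMul (𝒢 : TopGroupoid G₀ G₁) (hd : IsOpenMap 𝒢.d) {U V : Set G₁}
    (hU : IsOpen U) (hV : IsOpen V) : IsOpen (𝒢.setMul U V) := by
  refine isOpen_iff_forall_mem_open.2 fun z hz => ?_
  obtain ⟨x, hx, h, hxz⟩ := 𝒢.mem_setMul_iff.1 hz
  obtain ⟨A, B, hA, hB, hxA, hzB, hAB⟩ := 𝒢.exists_open_leftDiv_mem hV h hxz
  refine ⟨B ∩ 𝒢.d ⁻¹' (𝒢.d '' (A ∩ U)), ?_,
    hB.inter ((hd _ (hA.inter hU)).preimage 𝒢.continuous_d), hzB, x, ⟨hxA, hx⟩, h⟩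
  rintro w ⟨hwB, x', ⟨hx'A, hx'U⟩, hx'w⟩
  exact 𝒢.mem_setMul_iff.2 ⟨x', hx'U, hx'w, hAB x' hx'A w hwB hx'w⟩

theorem setMul_univ (𝒢 : TopGroupoid G₀ G₁) (U : Set G₁) :
    𝒢.setMul U univ = 𝒢.d ⁻¹' (𝒢.d '' U) := by
  ext z
  simp [mem_setMul_iff]

theorem isOpenMap_d (𝒢 : TopGroupoid G₀ G₁)
    (h : ∀ U : Set G₁, IsOpen U → IsOpen (𝒢.setMul U univ)) : IsOpenMap 𝒢.d := by
  intro U hU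
  have hO := (h U hU).preimage 𝒢.continuous_u
  rwa [setMul_univ, ← preimage_comp, (funext 𝒢.d_u : 𝒢.d ∘ 𝒢.u = id), preimage_id] at hO

theorem isOpen_range_u (𝒢 : TopGroupoid G₀ G₁) (hd : IsLocalHomeomorph 𝒢.d) :
    IsOpen (range 𝒢.u) := by
  refine (hd.isOpenEmbedding_of_comp ?_ 𝒢.continuous_u).isOpen_range
  rw [(funext 𝒢.d_u : 𝒢.d ∘ 𝒢.u = id)]
  exact .id

theorem isLocalHomeomorph_d (𝒢 : TopGroupoid G₀ G₁) (hd : IsOpenMap 𝒢.d)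
    (hu : IsOpen (range 𝒢.u)) : IsLocalHomeomorph 𝒢.d := by
  refine isLocalHomeomorph_iff_isOpenEmbedding_restrict.2 fun x => ?_
  obtain ⟨A, B, hA, hB, hxA, hxB, hAB⟩ :=
    𝒢.exists_open_leftDiv_mem hu rfl ⟨𝒢.r x, (𝒢.leftDiv_self x).symm⟩
  have hO : IsOpen (A ∩ B) := hA.inter hB
  refine ⟨A ∩ B, hO.mem_nhds ⟨hxA, hxB⟩, .of_continuous_injective_isOpenMap
    (𝒢.continuous_d.comp continuous_subtype_val) ?_ (hd.domRestrict hO)⟩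
  exact injOn_iff_injective.1 fun y hy z hz h =>
    𝒢.eq_of_leftDiv_mem_range_u h (hAB y hy.1 z hz.2 h)

end TopGroupoid

/-- A topological groupoid is étale (the domain map is a local homeomorphism) if and only if
the image of the unit map is open in `G₁` and the pointwise product of any two open subsets
of `G₁` is open. -/
theorem etale_iff_unitsOpen_and_setMul_open (𝒢 : TopGroupoid G₀ G₁) :
    IsLocalHomeomorph 𝒢.d ↔
      IsOpen (Set.range 𝒢.u) ∧
        ∀ U V : Set G₁, IsOpen U → IsOpen V → IsOpen (𝒢.setMul U V) :=
  ⟨fun hd => ⟨𝒢.isOpen_range_u hd, fun _ _ => 𝒢.isOpen_setMul hd.isOpenMap⟩,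
    fun ⟨hu, hm⟩ => 𝒢.isLocalHomeomorph_d
      (𝒢.isOpenMap_d fun U hU => hm U Set.univ hU isOpen_univ) hu⟩
end

section
/- In a topological groupoid, the domain map d : G₁ → G₀ is an open map if and only if the multiplication m : G₁ ×_{G₀} G₁ → G₁ is an open map (where G₁ ×_{G₀} G₁ carries the subspace topology of the product G₁ × G₁). -/
variable {G₀ G₁ : Type*} [TopologicalSpace G₀] [TopologicalSpace G₁]

/-- The second projection from the fibre product of `f` and `g` is open if `f` is open. -/
theorem IsOpenMap.snd_comp_subtypeVal {X Y Z : Type*} [TopologicalSpace X] [TopologicalSpace Y]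
    [TopologicalSpace Z] {f : X → Z} {g : Y → Z} (hf : IsOpenMap f) (hg : Continuous g) :
    IsOpenMap fun p : {p : X × Y // f p.1 = g p.2} => p.1.2 := by
  rintro _ ⟨W, hW, rfl⟩
  rw [isOpen_iff_mem_nhds]
  rintro _ ⟨⟨⟨x, y⟩, hxy⟩, hmem, rfl⟩
  obtain ⟨U, V, hU, hV, hx, hy, hUV⟩ := isOpen_prod_iff.1 hW x y hmem
  have h_nhds : V ∩ g ⁻¹' (f '' U) ∈ nhds y :=
    (hV.inter ((hf U hU).preimage hg)).mem_nhds ⟨hy, x, hx, hxy⟩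
  filter_upwards [h_nhds]
  rintro y' ⟨hy', x', hx', hxy'⟩
  exact ⟨⟨(x', y'), hxy'⟩, hUV ⟨hx', hy'⟩, rfl⟩

namespace TopGroupoid

variable (𝒢 : TopGroupoid G₀ G₁)

theorem mul_inv_mul_cancel_left (x z : G₁) (h : 𝒢.d x = 𝒢.d z) :
    𝒢.m ⟨(x, 𝒢.m ⟨(𝒢.i x, z), (𝒢.r_i x).trans h⟩),
      ((𝒢.d_m _).trans (𝒢.d_i x)).symm⟩ = z := by
  rw [← 𝒢.mul_assoc x (𝒢.i x) z (𝒢.d_i x).symm ((𝒢.r_i x).trans h)]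
  simp only [𝒢.mul_inv_right, h, 𝒢.mul_unit_left]

theorem inv_mul_mul_cancel_left (x y : G₁) (h : 𝒢.r x = 𝒢.d y) :
    𝒢.m ⟨(𝒢.i x, 𝒢.m ⟨(x, y), h⟩), (𝒢.r_i x).trans (𝒢.d_m ⟨(x, y), h⟩).symm⟩ = y := by
  rw [← 𝒢.mul_assoc (𝒢.i x) x y (𝒢.r_i x) h]
  simp only [𝒢.mul_inv_left, h, 𝒢.mul_unit_left]

/-- The map `(x, z) ↦ (x, x⁻¹z)` from pairs with a common domain to composable pairs. -/
def shear (p : {p : G₁ × G₁ // 𝒢.d p.1 = 𝒢.d p.2}) : {p : G₁ × G₁ // 𝒢.r p.1 = 𝒢.d p.2} :=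
  ⟨(p.1.1, 𝒢.m ⟨(𝒢.i p.1.1, p.1.2), (𝒢.r_i _).trans p.2⟩), ((𝒢.d_m _).trans (𝒢.d_i _)).symm⟩

theorem continuous_shear : Continuous 𝒢.shear := by
  have hi := 𝒢.continuous_i
  refine Continuous.subtype_mk (Continuous.prodMk (by fun_prop) ?_) _
  exact 𝒢.continuous_m.comp (Continuous.subtype_mk (by fun_prop) _)

theorem surjective_shear : Function.Surjective 𝒢.shear := by
  rintro ⟨⟨x, y⟩, h⟩
  exact ⟨⟨(x, 𝒢.m ⟨(x, y), h⟩), (𝒢.d_m ⟨(x, y), h⟩).symm⟩,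
    Subtype.ext (Prod.ext rfl (𝒢.inv_mul_mul_cancel_left x y h))⟩

theorem m_shear (p : {p : G₁ × G₁ // 𝒢.d p.1 = 𝒢.d p.2}) : 𝒢.m (𝒢.shear p) = p.1.2 :=
  𝒢.mul_inv_mul_cancel_left p.1.1 p.1.2 p.2

theorem isOpenMap_m (hd : IsOpenMap 𝒢.d) : IsOpenMap 𝒢.m := by
  refine IsOpenMap.of_comp 𝒢.continuous_shear 𝒢.surjective_shear ?_
  rw [show 𝒢.m ∘ 𝒢.shear = fun p => p.1.2 from funext 𝒢.m_shear]
  exact hd.snd_comp_subtypeVal 𝒢.continuous_d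

theorem image_d_eq (U : Set G₁) :
    𝒢.d '' U = 𝒢.u ⁻¹' (𝒢.m '' {p | p.1.1 ∈ U}) := by
  ext a
  constructor
  · rintro ⟨x, hx, rfl⟩
    exact ⟨⟨(x, 𝒢.i x), (𝒢.d_i x).symm⟩, hx, 𝒢.mul_inv_right x⟩
  · rintro ⟨p, hp, h⟩
    exact ⟨p.1.1, hp, by rw [← 𝒢.d_m, h, 𝒢.d_u]⟩

theorem isOpenMap_d_s4 (hm : IsOpenMap 𝒢.m) : IsOpenMap 𝒢.d := fun U hU => by
  rw [𝒢.image_d_eq]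
  exact (hm _ (hU.preimage (continuous_fst.comp continuous_subtype_val))).preimage 𝒢.continuous_u

end TopGroupoid

/-- In a topological groupoid, the domain map is open iff the multiplication map
(on the subspace of composable pairs) is open. -/
theorem isOpenMap_d_iff_isOpenMap_m (𝒢 : TopGroupoid G₀ G₁) :
    IsOpenMap 𝒢.d ↔ IsOpenMap 𝒢.m :=
  ⟨𝒢.isOpenMap_m, 𝒢.isOpenMap_d_s4⟩
end

section
/- In an open topological groupoid (d an open map), the pointwise product U·V of any two open subsets U, V ⊆ G₁ is an open subset of G₁. -/
variable {G₀ G₁ : Type*} [TopologicalSpace G₀] [TopologicalSpace G₁]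

theorem TopGroupoid.m_i_m (𝒢 : TopGroupoid G₀ G₁) (x y : G₁) (h : 𝒢.r x = 𝒢.d y) :
    𝒢.m ⟨(𝒢.i x, 𝒢.m ⟨(x, y), h⟩), (𝒢.r_i x).trans (𝒢.d_m ⟨(x, y), h⟩).symm⟩ = y := by
  rw [← 𝒢.mul_assoc (𝒢.i x) x y (𝒢.r_i x) h]
  simp only [𝒢.mul_inv_left, h, 𝒢.mul_unit_left]

theorem TopGroupoid.m_m_i (𝒢 : TopGroupoid G₀ G₁) (x z : G₁) (h : 𝒢.r (𝒢.i x) = 𝒢.d z) :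
    𝒢.m ⟨(x, 𝒢.m ⟨(𝒢.i x, z), h⟩), (𝒢.d_i x).symm.trans (𝒢.d_m ⟨(𝒢.i x, z), h⟩).symm⟩ = z := by
  have hx : 𝒢.d x = 𝒢.d z := (𝒢.r_i x).symm.trans h
  rw [← 𝒢.mul_assoc x (𝒢.i x) z (𝒢.d_i x).symm h]
  simp only [𝒢.mul_inv_right, hx, 𝒢.mul_unit_left]

/-- Left division `(x, z) ↦ x⁻¹ z` on pairs of arrows with the same domain. -/
def TopGroupoid.leftDiv_s5 (𝒢 : TopGroupoid G₀ G₁) (p : {p : G₁ × G₁ // 𝒢.d p.1 = 𝒢.d p.2}) : G₁ :=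
  𝒢.m ⟨(𝒢.i p.1.1, p.1.2), (𝒢.r_i p.1.1).trans p.2⟩

theorem TopGroupoid.continuous_leftDiv_s5 (𝒢 : TopGroupoid G₀ G₁) : Continuous 𝒢.leftDiv_s5 := by
  have hi := 𝒢.continuous_i
  refine 𝒢.continuous_m.comp (Continuous.subtype_mk ?_ _)
  fun_prop

theorem TopGroupoid.mem_setMul_iff_s5 (𝒢 : TopGroupoid G₀ G₁) {U V : Set G₁} {z : G₁} :
    z ∈ 𝒢.setMul U V ↔ ∃ x ∈ U, ∃ h : 𝒢.d x = 𝒢.d z, 𝒢.leftDiv_s5 ⟨(x, z), h⟩ ∈ V := by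
  constructor
  · rintro ⟨⟨⟨x, y⟩, h⟩, hx, hy, rfl⟩
    refine ⟨x, hx, (𝒢.d_m ⟨(x, y), h⟩).symm, ?_⟩
    rwa [TopGroupoid.leftDiv_s5, 𝒢.m_i_m x y h]
  · rintro ⟨x, hx, h, hV⟩
    exact ⟨⟨(x, 𝒢.leftDiv_s5 ⟨(x, z), h⟩), (𝒢.d_i x).symm.trans
      (𝒢.d_m ⟨(𝒢.i x, z), (𝒢.r_i x).trans h⟩).symm⟩, hx, hV,
      (𝒢.m_m_i x z ((𝒢.r_i x).trans h)).symm⟩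

/-- In an open topological groupoid, the pointwise product of two open subsets of the arrow
space is open. -/
theorem isOpen_setMul_of_isOpenMap_d (𝒢 : TopGroupoid G₀ G₁) (hd : IsOpenMap 𝒢.d)
    (U V : Set G₁) (hU : IsOpen U) (hV : IsOpen V) : IsOpen (𝒢.setMul U V) := by
  rw [isOpen_iff_forall_mem_open]
  intro z hz
  obtain ⟨x, hx, hxz, hV'⟩ := 𝒢.mem_setMul_iff_s5.1 hz
  obtain ⟨W, hW, hWV⟩ := isOpen_induced_iff.1 (hV.preimage 𝒢.continuous_leftDiv_s5)
  have hmem (p) : p.1 ∈ W ↔ 𝒢.leftDiv_s5 p ∈ V := Set.ext_iff.1 hWV p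
  obtain ⟨A, B, hA, hB, hxA, hzB, hAB⟩ := isOpen_prod_iff.1 hW x z ((hmem ⟨(x, z), hxz⟩).2 hV')
  refine ⟨B ∩ 𝒢.d ⁻¹' (𝒢.d '' (A ∩ U)), ?_,
    hB.inter ((hd _ (hA.inter hU)).preimage 𝒢.continuous_d), hzB, x, ⟨hxA, hx⟩, hxz⟩
  rintro w ⟨hwB, y, ⟨hyA, hyU⟩, hyw⟩
  exact 𝒢.mem_setMul_iff_s5.2 ⟨y, hyU, hyw, (hmem ⟨(y, w), hyw⟩).1 (hAB ⟨hyA, hwB⟩)⟩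
end

section
/- For an étale topological groupoid, let (s_j : U_j → G₁)_{j ∈ J} be a family of local bisections such that for all j, k ∈ J: s_j and s_k agree on U_j ∩ U_k, and for all a ∈ U_j and b ∈ U_k, if r(s_j a) = r(s_k b) then s_j a = s_k b. Then the glued map s : ⋃_j U_j → G₁, defined by s a = s_j a for a ∈ U_j, is well defined and is a local bisection. (In particular the inverse semigroup of local bisections is complete: every pairwise compatible family has a supremum.) -/
variable {G₀ G₁ : Type*} [TopologicalSpace G₀] [TopologicalSpace G₁]

/-- `s : G₀ → G₁` is a local bisection with (open) domain `U`: it is continuous on `U`,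
a section of the domain map on `U`, and `r ∘ s` restricted to `U` is an open embedding
(a homeomorphism onto an open subset of `G₀`). -/
def TopGroupoid.IsLocalBisection (𝒢 : TopGroupoid G₀ G₁) (U : Set G₀) (s : G₀ → G₁) : Prop :=
  IsOpen U ∧ ContinuousOn s U ∧ (∀ a ∈ U, 𝒢.d (s a) = a) ∧
    Topology.IsOpenEmbedding (U.restrict (fun a => 𝒢.r (s a)))

/-- In an étale topological groupoid, a pairwise compatible family of local bisections
`s j : U j → G₁` (the `s j` agree on overlaps of their domains, and any two values with the
same range are equal) glues to a well-defined local bisection on `⋃ j, U j`. -/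
theorem glue_localBisections (𝒢 : TopGroupoid G₀ G₁) (hd : IsLocalHomeomorph 𝒢.d)
    {J : Type*} (U : J → Set G₀) (s : J → G₀ → G₁)
    (hs : ∀ j, 𝒢.IsLocalBisection (U j) (s j))
    (hagree : ∀ j k, Set.EqOn (s j) (s k) (U j ∩ U k))
    (hcompat : ∀ j k, ∀ a ∈ U j, ∀ b ∈ U k,
      𝒢.r (s j a) = 𝒢.r (s k b) → s j a = s k b) :
    ∃ g : G₀ → G₁, 𝒢.IsLocalBisection (⋃ j, U j) g ∧
      ∀ j, Set.EqOn g (s j) (U j) := by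
  classical
  let g : G₀ → G₁ := fun a => if h : ∃ j, a ∈ U j then s h.choose a else 𝒢.u a
  have hg : ∀ j, Set.EqOn g (s j) (U j) := by
    intro j a ha
    have h : ∃ j, a ∈ U j := ⟨j, ha⟩
    simp only [g, dif_pos h]
    exact hagree _ _ ⟨h.choose_spec, ha⟩
  have hcont : ContinuousOn g (⋃ j, U j) :=
    ContinuousOn.iUnion_of_isOpen (fun j => (hs j).2.1.congr (hg j)) fun j => (hs j).1
  have hsec : ∀ a ∈ ⋃ j, U j, 𝒢.d (g a) = a := by
    intro a ha
    obtain ⟨j, hj⟩ := Set.mem_iUnion.1 ha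
    rw [hg j hj, (hs j).2.2.1 a hj]
  refine ⟨g, ⟨isOpen_iUnion fun j => (hs j).1, hcont, hsec, ?_⟩, hg⟩
  refine .of_continuous_injective_isOpenMap
    (𝒢.continuous_r.comp_continuousOn hcont).domRestrict ?_ ?_
  · rintro ⟨a, ha⟩ ⟨b, hb⟩ hab
    obtain ⟨j, hj⟩ := Set.mem_iUnion.1 ha
    obtain ⟨k, hk⟩ := Set.mem_iUnion.1 hb
    replace hab : 𝒢.r (g a) = 𝒢.r (g b) := hab
    have h : g a = g b := by
      rw [hg j hj, hg k hk] at hab ⊢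
      exact hcompat j k a hj b hk hab
    exact Subtype.ext ((hsec a ha).symm.trans ((congrArg 𝒢.d h).trans (hsec b hb)))
  · rintro _ ⟨V, hV, rfl⟩
    change IsOpen ((⋃ j, U j).domRestrict (fun a => 𝒢.r (g a)) '' (Subtype.val ⁻¹' V))
    have himage : (⋃ j, U j).domRestrict (fun a => 𝒢.r (g a)) '' (Subtype.val ⁻¹' V) =
        ⋃ j, (U j).domRestrict (fun a => 𝒢.r (s j a)) '' (Subtype.val ⁻¹' V) := by
      ext x
      simp only [Set.mem_iUnion, Set.mem_image, Set.mem_preimage, Subtype.exists]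
      constructor
      · rintro ⟨a, ⟨j, hj⟩, haV, rfl⟩
        exact ⟨j, a, hj, haV, congrArg 𝒢.r (hg j hj).symm⟩
      · rintro ⟨j, a, hj, haV, rfl⟩
        exact ⟨a, ⟨j, hj⟩, haV, congrArg 𝒢.r (hg j hj)⟩
    exact himage ▸ isOpen_iUnion fun j =>
      (hs j).2.2.2.isOpenMap _ (hV.preimage continuous_subtype_val)
end

section
/- Let G be an open topological groupoid (d an open map), let p : X → G₀ be a continuous open map from a topological space X, and let α : X ×_{G₀} G₁ → X be a continuous action, i.e. α is defined on the subspace X ×_{G₀} G₁ = {(x,g) ∈ X × G₁ | p x = d g} and satisfies p(α(x,g)) = r g, α(x, u(p x)) = x, and α(α(x,g), h) = α(x, m(g,h)) whenever r g = d h. Then α is an open map. -/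
variable {G₀ G₁ : Type*} [TopologicalSpace G₀] [TopologicalSpace G₁]

/-- The first projection of a fibre product along an open map is open. -/
theorem isOpenMap_fst_fiberProduct {X Y B : Type*} [TopologicalSpace X] [TopologicalSpace Y]
    [TopologicalSpace B] {p : X → B} {d : Y → B} (hp : Continuous p) (hd : IsOpenMap d) :
    IsOpenMap fun q : {q : X × Y // p q.1 = d q.2} => q.1.1 := by
  rintro _ ⟨W, hW, rfl⟩
  refine isOpen_iff_mem_nhds.2 ?_
  rintro _ ⟨⟨⟨x, y⟩, hxy⟩, hmem, rfl⟩
  obtain ⟨U, V, hU, hV, hxU, hyV, hUV⟩ := isOpen_prod_iff.1 hW x y hmem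
  refine Filter.mem_of_superset
    ((hU.inter ((hd V hV).preimage hp)).mem_nhds ⟨hxU, y, hyV, hxy.symm⟩) ?_
  rintro x' ⟨hx'U, y', hy'V, hy'⟩
  exact ⟨⟨(x', y'), hy'.symm⟩, hUV ⟨hx'U, hy'V⟩, rfl⟩

/-- Let `G` be an open topological groupoid, `p : X → G₀` a continuous open map and
`α : X ×_{G₀} G₁ → X` a continuous action of `G` on `p` (defined on the subspace of pairs
`(x, g)` with `p x = d g`, satisfying `p (α (x, g)) = r g`, the unit law and the
associativity law). Then `α` is an open map. -/
theorem action_isOpenMap {X : Type*} [TopologicalSpace X]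
    (𝒢 : TopGroupoid G₀ G₁) (hd : IsOpenMap 𝒢.d)
    (p : X → G₀) (hp : Continuous p) (hpo : IsOpenMap p)
    (α : {q : X × G₁ // p q.1 = 𝒢.d q.2} → X)
    (hα : Continuous α)
    (hpα : ∀ q, p (α q) = 𝒢.r q.1.2)
    (hunit : ∀ x : X, α ⟨(x, 𝒢.u (p x)), (𝒢.d_u (p x)).symm⟩ = x)
    (hassoc : ∀ (x : X) (g h : G₁) (hxg : p x = 𝒢.d g) (hgh : 𝒢.r g = 𝒢.d h),
      α ⟨(α ⟨(x, g), hxg⟩, h), (hpα ⟨(x, g), hxg⟩).trans hgh⟩ =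
      α ⟨(x, 𝒢.m ⟨(g, h), hgh⟩), hxg.trans (𝒢.d_m ⟨(g, h), hgh⟩).symm⟩) :
    IsOpenMap α := by
  let φ : {q : X × G₁ // p q.1 = 𝒢.d q.2} → {q : X × G₁ // p q.1 = 𝒢.d q.2} :=
    fun q => ⟨(α q, 𝒢.i q.1.2), (hpα q).trans (𝒢.d_i q.1.2).symm⟩
  have hφ : Continuous φ :=
    (hα.prodMk (𝒢.continuous_i.comp (continuous_snd.comp continuous_subtype_val))).subtype_mk _
  have hinv : Function.Involutive φ := by
    rintro ⟨⟨x, g⟩, hxg⟩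
    refine Subtype.ext (Prod.ext ?_ (𝒢.i_i g))
    refine (hassoc x g (𝒢.i g) hxg (𝒢.d_i g).symm).trans (Eq.trans ?_ (hunit x))
    congr 3
    exact (𝒢.mul_inv_right g).trans (congrArg 𝒢.u hxg.symm)
  let e : {q : X × G₁ // p q.1 = 𝒢.d q.2} ≃ₜ {q : X × G₁ // p q.1 = 𝒢.d q.2} :=
    ⟨hinv.toPerm φ, hφ, hφ⟩
  exact (isOpenMap_fst_fiberProduct hp hd).comp e.isOpenMap
end
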